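/- No nontrivial quantization of P¹ can be admissibly extended beyond P¹: for every Poisson subalgebra C of P with P¹ ⊊ C, every admissible quantization of (C, P¹) is trivial, i.e., satisfies Q(S₁) = Q(S₂) = Q(S₃) = 0. -/

import Mathlib

open MvPolynomial MeasureTheory

noncomputable section

attribute [local instance] Classical.propDecidable

/-- The Poisson bracket on `ℝ[X₀,X₁,X₂]` associated to the sphere:
`{f,g} = Σ εᵢⱼₖ Xᵢ ∂f/∂Xⱼ ∂g/∂Xₖ` (indices `0,1,2` play the role of `1,2,3`). -/
def pb (f g : MvPolynomial (Fin 3) ℝ) : MvPolynomial (Fin 3) ℝ :=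
  X 0 * (pderiv 1 f * pderiv 2 g - pderiv 2 f * pderiv 1 g) +
  X 1 * (pderiv 2 f * pderiv 0 g - pderiv 0 f * pderiv 2 g) +
  X 2 * (pderiv 0 f * pderiv 1 g - pderiv 1 f * pderiv 0 g)

/-- The ideal generated by `X₀² + X₁² + X₂² - s²`. -/
def sphereIdeal (s : ℝ) : Ideal (MvPolynomial (Fin 3) ℝ) :=
  Ideal.span {X 0 ^ 2 + X 1 ^ 2 + X 2 ^ 2 - C (s ^ 2)}

/-- The Poisson algebra `P` of polynomial functions on the sphere of radius `s`. -/
abbrev SpherePoly (s : ℝ) := MvPolynomial (Fin 3) ℝ ⧸ sphereIdeal s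

/-- The quotient map `ℝ[X₀,X₁,X₂] → P`. -/
def toSphere (s : ℝ) : MvPolynomial (Fin 3) ℝ →+* SpherePoly s :=
  Ideal.Quotient.mk (sphereIdeal s)

/-- The components `S₁, S₂, S₃` of the spin vector (indexed by `Fin 3`). -/
def S (s : ℝ) (i : Fin 3) : SpherePoly s := toSphere s (X i)

/-- A choice of polynomial representative of an element of `P`. -/
def rep (s : ℝ) (p : SpherePoly s) : MvPolynomial (Fin 3) ℝ :=
  (Ideal.Quotient.mk_surjective (I := sphereIdeal s) p).choose

/-- The Poisson bracket descended to `P`.  (It is independent of the choice of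
representatives, since the bracket of any polynomial with the generator
`X₀² + X₁² + X₂² - s²` vanishes identically.) -/
def pbS (s : ℝ) (p q : SpherePoly s) : SpherePoly s :=
  toSphere s (pb (rep s p) (rep s q))

/-- `P¹`, the ℝ-linear span of `{1, S₁, S₂, S₃}` in `P`. -/
def P1 (s : ℝ) : Submodule ℝ (SpherePoly s) :=
  Submodule.span ℝ ({1, S s 0, S s 1, S s 2} : Set (SpherePoly s))

theorem one_mem_P1 (s : ℝ) : (1 : SpherePoly s) ∈ P1 s :=
  Submodule.subset_span (Set.mem_insert _ _)

theorem S_mem_P1 (s : ℝ) (i : Fin 3) : S s i ∈ P1 s := by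
  apply Submodule.subset_span
  fin_cases i <;> simp

/-- The bracket `pb` over an arbitrary coefficient ring. -/
def lieBr {k : Type*} [CommRing k] (f g : MvPolynomial (Fin 3) k) : MvPolynomial (Fin 3) k :=
  X 0 * (pderiv 1 f * pderiv 2 g - pderiv 2 f * pderiv 1 g) +
  X 1 * (pderiv 2 f * pderiv 0 g - pderiv 0 f * pderiv 2 g) +
  X 2 * (pderiv 0 f * pderiv 1 g - pderiv 1 f * pderiv 0 g)

/-- The generator of the ideal of the sphere, over an arbitrary coefficient ring. -/
def sphereGen {k : Type*} [CommRing k] (a : k) : MvPolynomial (Fin 3) k :=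
  X 0 ^ 2 + X 1 ^ 2 + X 2 ^ 2 - C (a ^ 2)

/-- Substitution of the third coordinate in a univariate polynomial. -/
def zonal {k : Type*} [CommRing k] : Polynomial k →ₐ[k] MvPolynomial (Fin 3) k :=
  Polynomial.aeval (X 2)

section bracket

variable {k : Type*} [CommRing k]

@[simp] theorem pderiv_zero_zonal (p : Polynomial k) : pderiv 0 (zonal p) = 0 := by
  simp [zonal, Derivation.map_aeval, pderiv_X]

@[simp] theorem pderiv_one_zonal (p : Polynomial k) : pderiv 1 (zonal p) = 0 := by
  simp [zonal, Derivation.map_aeval, pderiv_X]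

@[simp] theorem pderiv_two_zonal (p : Polynomial k) :
    pderiv 2 (zonal p) = zonal (Polynomial.derivative p) := by
  simp [zonal, Derivation.map_aeval]

@[simp] theorem zonal_X : zonal (Polynomial.X : Polynomial k) = X 2 := by simp [zonal]

@[simp] theorem zonal_C (a : k) : zonal (Polynomial.C a) = C a := by
  simp [zonal, algebraMap_eq]

theorem lieBr_add_left (f g h : MvPolynomial (Fin 3) k) :
    lieBr (f + g) h = lieBr f h + lieBr g h := by
  simp only [lieBr, map_add]; ring

theorem lieBr_add_right (f g h : MvPolynomial (Fin 3) k) :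
    lieBr f (g + h) = lieBr f g + lieBr f h := by
  simp only [lieBr, map_add]; ring

theorem lieBr_C_mul_left (a : k) (f g : MvPolynomial (Fin 3) k) :
    lieBr (C a * f) g = C a * lieBr f g := by
  simp only [lieBr, pderiv_C_mul]; ring

theorem lieBr_C_mul_right (a : k) (f g : MvPolynomial (Fin 3) k) :
    lieBr f (C a * g) = C a * lieBr f g := by
  simp only [lieBr, pderiv_C_mul]; ring

/-- The bracket with `f`, as a linear map. -/
def lieAd (f : MvPolynomial (Fin 3) k) : Module.End k (MvPolynomial (Fin 3) k) where
  toFun := lieBr f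
  map_add' := lieBr_add_right f
  map_smul' a g := by simp [MvPolynomial.smul_eq_C_mul, lieBr_C_mul_right]

theorem lieBr_sphereGen_mul_right (a : k) (f g : MvPolynomial (Fin 3) k) :
    lieBr f (sphereGen a * g) = sphereGen a * lieBr f g := by
  simp [lieBr, sphereGen, pderiv_X]; ring

theorem lieBr_sphereGen_mul_left (a : k) (f g : MvPolynomial (Fin 3) k) :
    lieBr (sphereGen a * f) g = sphereGen a * lieBr f g := by
  simp [lieBr, sphereGen, pderiv_X]; ring

theorem lieBr_X_one_X_two : lieBr (X 1) (X 2 : MvPolynomial (Fin 3) k) = X 0 := by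
  simp [lieBr, pderiv_X]

theorem lieBr_X_two_X_zero : lieBr (X 2) (X 0 : MvPolynomial (Fin 3) k) = X 1 := by
  simp [lieBr, pderiv_X]

theorem lieBr_zonal_mul_X_zero (p h : Polynomial k) :
    lieBr (zonal p) (zonal h * X 0) = zonal (Polynomial.derivative p * h) * X 1 := by
  simp [lieBr, pderiv_X]; ring

theorem lieBr_zonal_mul_X_one (p h : Polynomial k) :
    lieBr (zonal p) (zonal h * X 1) = -(zonal (Polynomial.derivative p * h) * X 0) := by
  simp [lieBr, pderiv_X]; ring

theorem lieBr_zonal_mul_X_zero_mul_X_one (a : k) (h : Polynomial k) :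
    lieBr (zonal h * X 0) (zonal h * X 1) =
      zonal (h ^ 2 * Polynomial.X -
        h * Polynomial.derivative h * (Polynomial.C (a ^ 2) - Polynomial.X ^ 2)) -
      sphereGen a * zonal (h * Polynomial.derivative h) := by
  simp [lieBr, pderiv_X, sphereGen]; ring

/-- The Legendre operator: the restriction of the Casimir operator to zonal polynomials. -/
def legendreOp (a : k) (q : Polynomial k) : Polynomial k :=
  Polynomial.derivative ((Polynomial.C (a ^ 2) - Polynomial.X ^ 2) * Polynomial.derivative q)

theorem lieBr_casimir_zonal (a : k) (q : Polynomial k) :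
    lieBr (X 0) (lieBr (X 0) (zonal q)) + lieBr (X 1) (lieBr (X 1) (zonal q)) =
      zonal (legendreOp a q) +
        sphereGen a * zonal (Polynomial.derivative (Polynomial.derivative q)) := by
  have hC : Polynomial.derivative (Polynomial.C a ^ 2) = 0 := by
    rw [← Polynomial.C_pow, Polynomial.derivative_C]
  simp [lieBr, pderiv_X, sphereGen, legendreOp, hC]; ring

theorem lieBr_X_two_weight (e : k) (he : e * e = -1) (m : ℕ) (p : Polynomial k) :
    lieBr (X 2) ((X 0 + C e * X 1) ^ m * zonal p) =
      C (-(e * m)) * ((X 0 + C e * X 1) ^ m * zonal p) := by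
  have hC : (C e * C e : MvPolynomial (Fin 3) k) = -1 := by rw [← C_mul, he]; simp
  cases m with
  | zero => simp [lieBr, pderiv_X]
  | succ n =>
    simp [lieBr, pderiv_X, Derivation.leibniz_pow]
    linear_combination ((n + 1) * X 1 * (X 0 + C e * X 1) ^ n * zonal p) * hC

/-- The effect on polynomial coefficients of the lowering operator acting on weight `n + 1`. -/
def lowerCoeff (a : k) (n : ℕ) (p : Polynomial k) : Polynomial k :=
  Polynomial.C (2 * (n + 1) : k) * Polynomial.X * p -
    (Polynomial.C (a ^ 2) - Polynomial.X ^ 2) * Polynomial.derivative p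

theorem lieBr_lower (a e : k) (he : e * e = -1) (n : ℕ) (p : Polynomial k) :
    lieBr (X 0 - C e * X 1) ((X 0 + C e * X 1) ^ (n + 1) * zonal p) =
      C e * ((X 0 + C e * X 1) ^ n * zonal (lowerCoeff a n p)) -
        sphereGen a *
          (C e * (X 0 + C e * X 1) ^ n * zonal (Polynomial.derivative p)) := by
  have hC : (C e * C e : MvPolynomial (Fin 3) k) = -1 := by rw [← C_mul, he]; simp
  have h2 : (C 2 : MvPolynomial (Fin 3) k) = 2 := map_ofNat C 2
  simp [lieBr, pderiv_X, Derivation.leibniz_pow, sphereGen, lowerCoeff, h2]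
  linear_combination
    -(X 0 * X 1 * zonal (Polynomial.derivative p) * (X 0 + C e * X 1) ^ n) * hC

end bracket

section complexification

/-- The coefficientwise inclusion of real polynomials in complex ones. -/
abbrev toComplex : MvPolynomial (Fin 3) ℝ →+* MvPolynomial (Fin 3) ℂ := map Complex.ofRealHom

/-- The complexification of a space of real polynomials. -/
def complexify (N : Submodule ℝ (MvPolynomial (Fin 3) ℝ)) :
    Submodule ℂ (MvPolynomial (Fin 3) ℂ) where
  carrier := {F | ∃ f ∈ N, ∃ g ∈ N, F = toComplex f + C Complex.I * toComplex g}
  zero_mem' := ⟨0, N.zero_mem, 0, N.zero_mem, by simp⟩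
  add_mem' := by
    rintro _ _ ⟨f, hf, g, hg, rfl⟩ ⟨f', hf', g', hg', rfl⟩
    exact ⟨f + f', N.add_mem hf hf', g + g', N.add_mem hg hg', by simp only [map_add]; ring⟩
  smul_mem' := by
    rintro c _ ⟨f, hf, g, hg, rfl⟩
    refine ⟨c.re • f - c.im • g, N.sub_mem (N.smul_mem _ hf) (N.smul_mem _ hg),
      c.re • g + c.im • f, N.add_mem (N.smul_mem _ hg) (N.smul_mem _ hf), ?_⟩
    have hI : (C Complex.I * C Complex.I : MvPolynomial (Fin 3) ℂ) = -1 := by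
      rw [← C_mul, Complex.I_mul_I]; simp
    have hc : (C c : MvPolynomial (Fin 3) ℂ) = C (c.re : ℂ) + C (c.im : ℂ) * C Complex.I := by
      rw [← C_mul, ← C_add, Complex.re_add_im]
    simp only [MvPolynomial.smul_eq_C_mul, map_add, map_sub, map_mul, map_C, hc,
      Complex.ofRealHom_eq_coe]
    linear_combination (C (c.im : ℂ) * toComplex g) * hI

variable {N : Submodule ℝ (MvPolynomial (Fin 3) ℝ)}

theorem toComplex_add_I_mul_injective {f g f' g' : MvPolynomial (Fin 3) ℝ}
    (h : toComplex f + C Complex.I * toComplex g = toComplex f' + C Complex.I * toComplex g') :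
    f = f' ∧ g = g' := by
  have key (m : Fin 3 →₀ ℕ) : coeff m f = coeff m f' ∧ coeff m g = coeff m g' := by
    have := congrArg (coeff m) h
    simp only [coeff_add, coeff_C_mul, coeff_map, Complex.ofRealHom_eq_coe, Complex.ext_iff] at this
    simpa using this
  exact ⟨MvPolynomial.ext _ _ fun m => (key m).1, MvPolynomial.ext _ _ fun m => (key m).2⟩

theorem toComplex_add_I_mul_mem_complexify {f g : MvPolynomial (Fin 3) ℝ} :
    toComplex f + C Complex.I * toComplex g ∈ complexify N ↔ f ∈ N ∧ g ∈ N := by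
  constructor
  · rintro ⟨f', hf', g', hg', h⟩
    obtain ⟨rfl, rfl⟩ := toComplex_add_I_mul_injective h
    exact ⟨hf', hg'⟩
  · rintro ⟨hf, hg⟩
    exact ⟨f, hf, g, hg, rfl⟩

theorem toComplex_mem_complexify {f : MvPolynomial (Fin 3) ℝ} :
    toComplex f ∈ complexify N ↔ f ∈ N := by
  simpa using toComplex_add_I_mul_mem_complexify (N := N) (f := f) (g := 0)

theorem complexify_top : complexify ⊤ = ⊤ := by
  refine eq_top_iff.2 fun F _ => ?_
  induction F using MvPolynomial.induction_on with
  | C a =>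
    have h : (1 : MvPolynomial (Fin 3) ℂ) ∈ complexify ⊤ := by
      simpa using toComplex_mem_complexify (N := ⊤) (f := 1)
    simpa [MvPolynomial.smul_eq_C_mul] using (complexify ⊤).smul_mem a h
  | add p q hp hq => exact add_mem (hp trivial) (hq trivial)
  | mul_X p i hp =>
    obtain ⟨f, -, g, -, rfl⟩ := hp trivial
    exact ⟨f * X i, trivial, g * X i, trivial, by simp only [map_mul, map_X]; ring⟩

theorem C_mul_mem_complexify (a : ℂ) {F : MvPolynomial (Fin 3) ℂ} (hF : F ∈ complexify N) :
    C a * F ∈ complexify N := by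
  simpa [MvPolynomial.smul_eq_C_mul] using (complexify N).smul_mem a hF

theorem C_mul_mem_complexify_iff {a : ℂ} (ha : a ≠ 0) {F : MvPolynomial (Fin 3) ℂ} :
    C a * F ∈ complexify N ↔ F ∈ complexify N := by
  simpa [MvPolynomial.smul_eq_C_mul] using (complexify N).smul_mem_iff ha (x := F)

theorem toComplex_sphereGen (s : ℝ) : toComplex (sphereGen s) = sphereGen (s : ℂ) := by
  simp [sphereGen]

theorem sphereGen_mul_mem_complexify {s : ℝ} (hN : ∀ f, sphereGen s * f ∈ N)
    (F : MvPolynomial (Fin 3) ℂ) : sphereGen (s : ℂ) * F ∈ complexify N := by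
  obtain ⟨f, -, g, -, rfl⟩ : F ∈ complexify ⊤ := complexify_top ▸ trivial
  refine ⟨_, hN f, _, hN g, ?_⟩
  rw [map_mul, map_mul, toComplex_sphereGen]; ring

theorem toComplex_lieBr (f g : MvPolynomial (Fin 3) ℝ) :
    toComplex (lieBr f g) = lieBr (toComplex f) (toComplex g) := by
  simp [lieBr, pderiv_map]

theorem lieBr_mem_complexify (hN : ∀ f ∈ N, ∀ g ∈ N, lieBr f g ∈ N)
    {F G : MvPolynomial (Fin 3) ℂ} (hF : F ∈ complexify N) (hG : G ∈ complexify N) :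
    lieBr F G ∈ complexify N := by
  obtain ⟨f, hf, g, hg, rfl⟩ := hF
  obtain ⟨f', hf', g', hg', rfl⟩ := hG
  simp only [lieBr_add_left, lieBr_add_right, lieBr_C_mul_left, lieBr_C_mul_right,
    ← toComplex_lieBr]
  have mem {f g} (hf : f ∈ N) (hg : g ∈ N) := toComplex_mem_complexify.2 (hN f hf g hg)
  exact add_mem (add_mem (mem hf hf') (C_mul_mem_complexify _ (mem hg hf')))
    (C_mul_mem_complexify _ (add_mem (mem hf hg') (C_mul_mem_complexify _ (mem hg hg'))))

theorem Polynomial.exists_eq_map_add_I_mul_map (p : Polynomial ℂ) :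
    ∃ f g : Polynomial ℝ, p = f.map Complex.ofRealHom +
      Polynomial.C Complex.I * g.map Complex.ofRealHom := by
  induction p using Polynomial.induction_on' with
  | add p q hp hq =>
    obtain ⟨f, g, rfl⟩ := hp
    obtain ⟨f', g', rfl⟩ := hq
    exact ⟨f + f', g + g', by simp only [Polynomial.map_add]; ring⟩
  | monomial n a =>
    refine ⟨Polynomial.monomial n a.re, Polynomial.monomial n a.im, ?_⟩
    rw [Polynomial.map_monomial, Polynomial.map_monomial, Polynomial.C_mul_monomial, ← map_add]
    congr 1
    rw [mul_comm]
    exact (Complex.re_add_im a).symm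

theorem toComplex_zonal (p : Polynomial ℝ) :
    toComplex (zonal p) = zonal (p.map Complex.ofRealHom) := by
  induction p using Polynomial.induction_on' with
  | add p q hp hq => simp only [map_add, Polynomial.map_add, hp, hq]
  | monomial n a => simp [← Polynomial.C_mul_X_pow_eq_monomial]

theorem exists_zonal_mem_of_complexify {p : Polynomial ℂ} (hp : zonal p ∈ complexify N) :
    ∃ q : Polynomial ℝ, zonal q ∈ N ∧ p.natDegree ≤ q.natDegree := by
  obtain ⟨f, g, rfl⟩ := p.exists_eq_map_add_I_mul_map
  rw [map_add, map_mul, zonal_C, ← toComplex_zonal, ← toComplex_zonal,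
    toComplex_add_I_mul_mem_complexify] at hp
  have h := (Polynomial.natDegree_add_le (f.map Complex.ofRealHom)
    (Polynomial.C Complex.I * g.map Complex.ofRealHom)).trans
    (max_le_max le_rfl (Polynomial.natDegree_C_mul_le _ _))
  rw [Polynomial.natDegree_map, Polynomial.natDegree_map] at h
  rcases le_max_iff.1 h with h | h
  · exact ⟨f, hp.1, h⟩
  · exact ⟨g, hp.2, h⟩

end complexification

section weights

theorem natDegree_lowerCoeff (a : ℂ) (n : ℕ) {p : Polynomial ℂ} (hp : p ≠ 0) :
    (lowerCoeff a n p).natDegree = p.natDegree + 1 := by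
  have hdeg : (lowerCoeff a n p).natDegree ≤ p.natDegree + 1 := by
    unfold lowerCoeff
    refine (Polynomial.natDegree_sub_le _ _).trans (max_le ?_ ?_)
    · rw [mul_assoc]
      refine (Polynomial.natDegree_C_mul_le _ _).trans (Polynomial.natDegree_mul_le.trans ?_)
      rw [Polynomial.natDegree_X, add_comm]
    · rcases Nat.eq_zero_or_pos p.natDegree with h | h
      · rw [Polynomial.derivative_of_natDegree_zero h]; simp
      · have h1 := Polynomial.natDegree_derivative_lt h.ne'
        have h2 : (Polynomial.C (a ^ 2) - Polynomial.X ^ 2 : Polynomial ℂ).natDegree ≤ 2 := by compute_degree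
        have h3 := Polynomial.natDegree_mul_le
          (p := Polynomial.C (a ^ 2) - Polynomial.X ^ 2) (q := Polynomial.derivative p)
        omega
  refine Polynomial.natDegree_eq_of_le_of_coeff_ne_zero hdeg ?_
  have hcoeff : (lowerCoeff a n p).coeff (p.natDegree + 1) =
      (2 * (n + 1) + p.natDegree) * p.leadingCoeff := by
    have h0 : (Polynomial.derivative p).coeff (p.natDegree + 1) = 0 := by
      rw [Polynomial.coeff_derivative, Polynomial.coeff_eq_zero_of_natDegree_lt (by omega), zero_mul]
    have h1 : (Polynomial.X ^ 2 * Polynomial.derivative p).coeff (p.natDegree + 1) =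
        p.natDegree * p.leadingCoeff := by
      rcases Nat.eq_zero_or_pos p.natDegree with h | h
      · rw [Polynomial.derivative_of_natDegree_zero h, h]; simp
      · obtain ⟨d, hd⟩ : ∃ d, p.natDegree = d + 1 := ⟨p.natDegree - 1, by omega⟩
        rw [Polynomial.leadingCoeff, hd, mul_comm, Polynomial.coeff_mul_X_pow,
          Polynomial.coeff_derivative]
        push_cast; ring
    rw [lowerCoeff, Polynomial.coeff_sub, mul_assoc, Polynomial.coeff_C_mul,
      Polynomial.coeff_X_mul, sub_mul, Polynomial.coeff_sub, Polynomial.coeff_C_mul, h0, h1,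
      Polynomial.leadingCoeff]
    ring
  rw [hcoeff]
  refine mul_ne_zero ?_ (Polynomial.leadingCoeff_ne_zero.2 hp)
  exact_mod_cast (by omega : 2 * (n + 1) + p.natDegree ≠ 0)

/-- Weight vectors: for `e = ± I`, the polynomial `(X₀ + e X₁) ^ n * p(X₂)`. -/
def weightPoly (e : ℂ) (n : ℕ) : Polynomial ℂ →ₗ[ℂ] MvPolynomial (Fin 3) ℂ :=
  LinearMap.mulLeft ℂ ((X 0 + C e * X 1) ^ n) ∘ₗ zonal.toLinearMap

theorem weightPoly_apply (e : ℂ) (n : ℕ) (p : Polynomial ℂ) :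
    weightPoly e n p = (X 0 + C e * X 1) ^ n * zonal p := rfl

/-- The imaginary unit with the sign of `k`. -/
def signI (k : ℤ) : ℂ := if 0 ≤ k then Complex.I else -Complex.I

theorem signI_mul_self (k : ℤ) : signI k * signI k = -1 := by
  unfold signI; split_ifs <;> simp

theorem signI_mul_natAbs (k : ℤ) : signI k * k.natAbs = Complex.I * k := by
  unfold signI
  split_ifs with h
  · rw [Nat.cast_natAbs, abs_of_nonneg h]
  · rw [Nat.cast_natAbs, abs_of_neg (not_le.1 h)]; push_cast; ring

/-- The space of vectors of weight `k`. -/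
def weightSpace (k : ℤ) : Submodule ℂ (MvPolynomial (Fin 3) ℂ) :=
  LinearMap.range (weightPoly (signI k) k.natAbs)

theorem weightPoly_mem_iSup (e : ℂ) (he : e = Complex.I ∨ e = -Complex.I) (n : ℕ)
    (p : Polynomial ℂ) : weightPoly e n p ∈ ⨆ k, weightSpace k := by
  rcases he with rfl | rfl
  · refine Submodule.mem_iSup_of_mem (n : ℤ) ⟨p, ?_⟩
    simp [signI]
  · rcases Nat.eq_zero_or_pos n with rfl | hn
    · refine Submodule.mem_iSup_of_mem 0 ⟨p, ?_⟩
      simp [weightPoly_apply]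
    · refine Submodule.mem_iSup_of_mem (-n : ℤ) ⟨p, ?_⟩
      simp [signI, hn.ne']

theorem lieBr_X_two_of_mem_weightSpace {k : ℤ} {F : MvPolynomial (Fin 3) ℂ}
    (hF : F ∈ weightSpace k) : lieBr (X 2) F = C (-(Complex.I * k)) * F := by
  obtain ⟨p, rfl⟩ := hF
  rw [weightPoly_apply, lieBr_X_two_weight _ (signI_mul_self k), signI_mul_natAbs]

theorem iSup_weightSpace_sup_sphere (a : ℂ) :
    (⨆ k, weightSpace k) ⊔ LinearMap.range (LinearMap.mulLeft ℂ (sphereGen a)) = ⊤ := by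
  set W := (⨆ k, weightSpace k) ⊔ LinearMap.range (LinearMap.mulLeft ℂ (sphereGen a)) with hW
  have hsph (G) : sphereGen a * G ∈ W := Submodule.mem_sup_right ⟨G, rfl⟩
  have hwt (e) (he : e = Complex.I ∨ e = -Complex.I) (n p) : weightPoly e n p ∈ W :=
    Submodule.mem_sup_left (weightPoly_mem_iSup e he n p)
  have hind (L : MvPolynomial (Fin 3) ℂ)
      (hL : ∀ e, (e = Complex.I ∨ e = -Complex.I) → ∀ n p, L * weightPoly e n p ∈ W)
      (F) (hF : F ∈ W) : L * F ∈ W := by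
    have : W ≤ W.comap (LinearMap.mulLeft ℂ L) := by
      refine sup_le (iSup_le ?_) ?_
      · rintro k _ ⟨p, rfl⟩
        refine hL _ ?_ _ p
        unfold signI; split_ifs <;> simp
      · rintro _ ⟨G, rfl⟩
        have := hsph (L * G)
        rwa [mul_left_comm] at this
    exact this hF
  have hU (e) (he : e = Complex.I ∨ e = -Complex.I) (F) (hF : F ∈ W) :
      (X 0 + C e * X 1) * F ∈ W := by
    refine hind _ (fun e' he' n p => ?_) F hF
    have hee : e' = e ∨ e' = -e := by
      rcases he with rfl | rfl <;> rcases he' with rfl | rfl <;> simp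
    rcases hee with rfl | rfl
    · have := hwt e' he (n + 1) p
      rwa [weightPoly_apply, pow_succ', mul_assoc] at this
    · cases n with
      | zero =>
        have := hwt e he 1 p
        simpa [weightPoly_apply] using this
      | succ n =>
        have he2 : e * e = -1 := by rcases he with rfl | rfl <;> simp
        have hC : (C e * C e : MvPolynomial (Fin 3) ℂ) = -1 := by rw [← C_mul, he2]; simp
        have h1 := hwt (-e) he' n ((Polynomial.C (a ^ 2) - Polynomial.X ^ 2) * p)
        have h2 := hsph (weightPoly (-e) n p)
        convert add_mem h1 h2 using 1
        simp only [weightPoly_apply, sphereGen, map_mul, map_sub, map_pow, zonal_X, zonal_C, C_neg]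
        linear_combination (-X 1 ^ 2 * (X 0 + -C e * X 1) ^ n * zonal p) * hC
  have hI := hU Complex.I (.inl rfl)
  have hI' := hU (-Complex.I) (.inr rfl)
  have hII : (C Complex.I * C Complex.I : MvPolynomial (Fin 3) ℂ) = -1 := by
    rw [← C_mul, Complex.I_mul_I]; simp
  have h2 : (C 2⁻¹ * 2 : MvPolynomial (Fin 3) ℂ) = 1 := by
    rw [← map_ofNat C 2, ← C_mul]; simp
  have hX (i : Fin 3) (F) (hF : F ∈ W) : X i * F ∈ W := by
    fin_cases i
    · change X 0 * F ∈ W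
      have h := W.smul_mem (2⁻¹ : ℂ) (add_mem (hI F hF) (hI' F hF))
      convert h using 1
      rw [MvPolynomial.smul_eq_C_mul, C_neg]
      linear_combination (-X 0 * F) * h2
    · change X 1 * F ∈ W
      have h := W.smul_mem (2⁻¹ * -Complex.I : ℂ) (sub_mem (hI F hF) (hI' F hF))
      convert h using 1
      simp only [MvPolynomial.smul_eq_C_mul, C_neg, C_mul]
      linear_combination (-X 1 * F) * h2 + (C 2⁻¹ * 2 * X 1 * F) * hII
    · change X 2 * F ∈ W
      refine hind _ (fun e he n p => ?_) F hF
      have := hwt e he n (Polynomial.X * p)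
      simpa only [weightPoly_apply, map_mul, zonal_X, mul_left_comm] using this
  refine eq_top_iff.2 fun F _ => ?_
  induction F using MvPolynomial.induction_on with
  | C b =>
    have := hwt Complex.I (.inl rfl) 0 (Polynomial.C b)
    simpa [weightPoly_apply] using this
  | add p q hp hq => exact add_mem (hp trivial) (hq trivial)
  | mul_X p i hp => rw [mul_comm]; exact hX i p (hp trivial)

/-- A subspace stable under an operator contains the components of its elements along eigenvectors
for distinct eigenvalues. -/
theorem Submodule.mem_of_sum_eigenvectors_mem {K M ι : Type*} [Field K] [AddCommGroup M]
    [Module K M] (N : Submodule K M) (T : Module.End K M) (hT : ∀ x ∈ N, T x ∈ N) (μ : ι → K)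
    (hμ : Function.Injective μ) (t : Finset ι) (v : ι → M) (hv : ∀ k ∈ t, T (v k) = μ k • v k)
    (hsum : ∑ k ∈ t, v k ∈ N) : ∀ k ∈ t, v k ∈ N := by
  induction t using Finset.induction_on generalizing v with
  | empty => simp
  | insert a t ha ih =>
    have h1 : ∑ k ∈ t, (μ k - μ a) • v k ∈ N := by
      have h := N.sub_mem (hT _ hsum) (N.smul_mem (μ a) hsum)
      rwa [map_sum, Finset.sum_congr rfl hv, Finset.smul_sum, ← Finset.sum_sub_distrib,
        Finset.sum_insert ha, sub_self, zero_add,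
        Finset.sum_congr rfl fun k _ => (sub_smul (μ k) (μ a) (v k)).symm] at h
    have h2 : ∀ k ∈ t, v k ∈ N := by
      intro k hk
      have hne : μ k - μ a ≠ 0 := sub_ne_zero.2 fun h => ha (hμ h ▸ hk)
      refine (N.smul_mem_iff hne).1 (ih (fun k => (μ k - μ a) • v k) (fun j hj => ?_) h1 k hk)
      rw [map_smul, hv j (Finset.mem_insert_of_mem hj), smul_comm]
    intro k hk
    rcases Finset.mem_insert.1 hk with rfl | hk
    · rw [Finset.sum_insert ha] at hsum
      exact (N.add_mem_iff_left (N.sum_mem h2)).1 hsum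
    · exact h2 k hk

variable {s : ℝ} {N : Submodule ℝ (MvPolynomial (Fin 3) ℝ)}

theorem exists_zonal_of_weightPoly (hsph : ∀ f, sphereGen s * f ∈ N)
    (hbr : ∀ f ∈ N, ∀ g ∈ N, lieBr f g ∈ N) (hX : ∀ i, X i ∈ N) {e : ℂ} (he : e * e = -1) (n : ℕ)
    {p : Polynomial ℂ} (hp0 : p ≠ 0) (hp : weightPoly e n p ∈ complexify N) :
    ∃ q : Polynomial ℂ, zonal q ∈ complexify N ∧ q.natDegree = n + p.natDegree := by
  induction n generalizing p with
  | zero => exact ⟨p, by simpa [weightPoly_apply] using hp, by simp⟩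
  | succ n ih =>
    have hX' (i) : (X i : MvPolynomial (Fin 3) ℂ) ∈ complexify N := by
      simpa using toComplex_mem_complexify.2 (hX i)
    have h := lieBr_mem_complexify hbr
      (sub_mem (hX' 0) (C_mul_mem_complexify e (hX' 1))) hp
    have he0 : e ≠ 0 := by rintro rfl; simp at he
    rw [weightPoly_apply, lieBr_lower (s : ℂ) e he,
      Submodule.sub_mem_iff_left _ (sphereGen_mul_mem_complexify hsph _),
      C_mul_mem_complexify_iff he0] at h
    have hdeg := natDegree_lowerCoeff (s : ℂ) n hp0
    obtain ⟨q, hq, hqd⟩ := ih (p := lowerCoeff (s : ℂ) n p)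
      (fun h0 => by rw [h0] at hdeg; simp at hdeg) h
    exact ⟨q, hq, by omega⟩

/-- A weight vector of total degree at most one is a complex combination of `1, X₀, X₁, X₂`. -/
theorem weightPoly_mem_of_degree_le_one (hone : 1 ∈ N) (hX : ∀ i, X i ∈ N) (e : ℂ) {n : ℕ}
    {p : Polynomial ℂ} (h : n + p.natDegree ≤ 1) : weightPoly e n p ∈ complexify N := by
  have hX' (i) : (X i : MvPolynomial (Fin 3) ℂ) ∈ complexify N := by
    simpa using toComplex_mem_complexify.2 (hX i)
  have h1 : (1 : MvPolynomial (Fin 3) ℂ) ∈ complexify N := by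
    simpa using toComplex_mem_complexify.2 hone
  have hC (a) : (C a : MvPolynomial (Fin 3) ℂ) ∈ complexify N := by
    simpa using C_mul_mem_complexify a h1
  rw [weightPoly_apply]
  obtain rfl | rfl : n = 0 ∨ n = 1 := by omega
  · rw [Polynomial.eq_X_add_C_of_natDegree_le_one (p := p) (by omega)]
    simpa using add_mem (C_mul_mem_complexify _ (hX' 2)) (hC _)
  · rw [Polynomial.eq_C_of_natDegree_eq_zero (p := p) (by omega), zonal_C, mul_comm, pow_one]
    exact C_mul_mem_complexify _ (add_mem (hX' 0) (C_mul_mem_complexify e (hX' 1)))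

/-- A Poisson subalgebra strictly larger than the one spanned by `1, X₀, X₁, X₂` contains a
zonal polynomial of degree at least two. -/
theorem exists_zonal_two_le_natDegree {N₁ : Submodule ℝ (MvPolynomial (Fin 3) ℝ)}
    (hsph₁ : ∀ f, sphereGen s * f ∈ N₁) (hone₁ : 1 ∈ N₁) (hX₁ : ∀ i, X i ∈ N₁)
    (hsph : ∀ f, sphereGen s * f ∈ N) (hbr : ∀ f ∈ N, ∀ g ∈ N, lieBr f g ∈ N)
    (hX : ∀ i, X i ∈ N) {f : MvPolynomial (Fin 3) ℝ} (hf : f ∈ N) (hf₁ : f ∉ N₁) :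
    ∃ q : Polynomial ℝ, zonal q ∈ N ∧ 2 ≤ q.natDegree := by
  rw [← toComplex_mem_complexify] at hf hf₁
  obtain ⟨F, hF, _, ⟨G, rfl⟩, hFG⟩ := Submodule.mem_sup.1
    (iSup_weightSpace_sup_sphere (s : ℂ) ▸ Submodule.mem_top : toComplex f ∈ _)
  obtain ⟨v, hv, rfl⟩ := (Submodule.mem_iSup_iff_exists_finsupp _ _).1 hF
  rw [← hFG, LinearMap.mulLeft_apply,
    Submodule.add_mem_iff_left _ (sphereGen_mul_mem_complexify hsph G)] at hf
  rw [← hFG, LinearMap.mulLeft_apply,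
    Submodule.add_mem_iff_left _ (sphereGen_mul_mem_complexify hsph₁ G)] at hf₁
  obtain ⟨k, hk, hk₁⟩ : ∃ k ∈ v.support, v k ∉ complexify N₁ := by
    by_contra! h
    exact hf₁ (Submodule.sum_mem _ h)
  have hX2 : (X 2 : MvPolynomial (Fin 3) ℂ) ∈ complexify N := by
    simpa using toComplex_mem_complexify.2 (hX 2)
  have hkN : v k ∈ complexify N := by
    refine (complexify N).mem_of_sum_eigenvectors_mem (lieAd (X 2))
      (fun x hx => lieBr_mem_complexify hbr hX2 hx) (fun k : ℤ => -(Complex.I * k))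
      (fun a b hab => ?_) v.support v (fun k _ => ?_) hf k hk
    · simpa using hab
    · rw [MvPolynomial.smul_eq_C_mul]
      exact lieBr_X_two_of_mem_weightSpace (hv k)
  obtain ⟨p, hp⟩ := hv k
  rw [← hp] at hkN hk₁
  have hdeg : 2 ≤ k.natAbs + p.natDegree := by
    by_contra! h
    exact hk₁ (weightPoly_mem_of_degree_le_one hone₁ hX₁ _ (by omega))
  have hp0 : p ≠ 0 := by
    rintro rfl
    exact hk₁ (by simp)
  obtain ⟨q, hq, hqd⟩ :=
    exists_zonal_of_weightPoly hsph hbr hX (signI_mul_self k) k.natAbs hp0 hkN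
  obtain ⟨r, hr, hrd⟩ := exists_zonal_mem_of_complexify hq
  exact ⟨r, hr, by omega⟩

end weights

section legendre

theorem coeff_legendreOp (a : ℝ) (q : Polynomial ℝ) (n : ℕ) :
    (legendreOp a q).coeff n =
      a ^ 2 * ((n + 1) * (n + 2)) * q.coeff (n + 2) - n * (n + 1) * q.coeff n := by
  rw [legendreOp, Polynomial.coeff_derivative, sub_mul, Polynomial.coeff_sub,
    Polynomial.coeff_C_mul, Polynomial.coeff_derivative, Polynomial.coeff_X_pow_mul']
  cases n with
  | zero => norm_num; ring
  | succ m =>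
    rw [if_pos (by omega), show m + 1 + 1 - 2 = m by omega, Polynomial.coeff_derivative]
    push_cast; ring

theorem integral_derivative_eval (p : Polynomial ℝ) (a b : ℝ) :
    ∫ t in a..b, (Polynomial.derivative p).eval t = p.eval b - p.eval a :=
  intervalIntegral.integral_eq_sub_of_hasDerivAt (fun t _ => p.hasDerivAt t)
    ((Polynomial.continuous _).intervalIntegrable _ _)

/-- The moment of a polynomial against the coordinate function on `[-s, s]`. -/
def firstMoment (s : ℝ) (q : Polynomial ℝ) : ℝ := ∫ t in -s..s, (q * Polynomial.X).eval t

theorem firstMoment_add_C_mul (s c : ℝ) (p q : Polynomial ℝ) :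
    firstMoment s (p + Polynomial.C c * q) = firstMoment s p + c * firstMoment s q := by
  simp only [firstMoment, add_mul, mul_assoc, Polynomial.eval_add, Polynomial.eval_C_mul]
  rw [intervalIntegral.integral_add ((Polynomial.continuous _).intervalIntegrable _ _)
    (((Polynomial.continuous _).intervalIntegrable _ _).const_mul _),
    intervalIntegral.integral_const_mul]

theorem firstMoment_legendreOp (s : ℝ) (q : Polynomial ℝ) :
    firstMoment s (legendreOp s q) = -2 * firstMoment s q := by
  set w : Polynomial ℝ := Polynomial.C (s ^ 2) - Polynomial.X ^ 2 with hw
  have hw' : Polynomial.derivative w = -(Polynomial.C 2 * Polynomial.X) := by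
    rw [hw, Polynomial.derivative_sub, Polynomial.derivative_C, Polynomial.derivative_X_sq, zero_sub]
  have hkey : (legendreOp s q + Polynomial.C 2 * q) * Polynomial.X =
      Polynomial.derivative (w * Polynomial.derivative q * Polynomial.X - w * q) := by
    simp only [legendreOp, ← hw, Polynomial.derivative_sub, Polynomial.derivative_mul, hw',
      Polynomial.derivative_X]
    ring
  have h : firstMoment s (legendreOp s q + Polynomial.C 2 * q) = 0 := by
    rw [firstMoment, hkey, integral_derivative_eval]
    simp [hw]
  rw [firstMoment_add_C_mul] at h
  linarith

theorem X_mem_of_firstMoment_ne_zero {s : ℝ} (N : Submodule ℝ (Polynomial ℝ))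
    (hN : ∀ q ∈ N, legendreOp s q ∈ N) (d : ℕ) {g : Polynomial ℝ} (hg : g ∈ N)
    (hd : g.natDegree ≤ d + 1) (hint : firstMoment s g ≠ 0) :
    (Polynomial.X : Polynomial ℝ) ∈ N := by
  induction d generalizing g with
  | zero =>
    have hL : legendreOp s g = (-2 * g.coeff 1) • (Polynomial.X : Polynomial ℝ) := by
      ext n
      rw [coeff_legendreOp, Polynomial.coeff_smul, Polynomial.coeff_X,
        Polynomial.coeff_eq_zero_of_natDegree_lt (by omega)]
      rcases Nat.lt_trichotomy n 1 with h | rfl | h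
      · obtain rfl : n = 0 := by omega
        simp
      · norm_num
      · rw [Polynomial.coeff_eq_zero_of_natDegree_lt (by omega), if_neg (by omega)]
        simp
    have hmem := hN g hg
    have hne : -2 * g.coeff 1 ≠ 0 := by
      intro h0
      have h1 := firstMoment_legendreOp s g
      rw [hL, h0, zero_smul, firstMoment] at h1
      simp at h1
      exact hint h1
    rw [hL] at hmem
    exact (N.smul_mem_iff hne).1 hmem
  | succ d ih =>
    set c : ℝ := (d + 2) * (d + 3) with hc
    refine ih (g := legendreOp s g + Polynomial.C c * g) ?_ ?_ ?_
    · rw [← Polynomial.smul_eq_C_mul]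
      exact N.add_mem (hN g hg) (N.smul_mem c hg)
    · rw [Polynomial.natDegree_le_iff_coeff_eq_zero]
      intro n hn
      rw [Polynomial.coeff_add, Polynomial.coeff_C_mul, coeff_legendreOp,
        Polynomial.coeff_eq_zero_of_natDegree_lt (n := n + 2) (by omega)]
      rcases (show d + 2 ≤ n by omega).eq_or_lt with rfl | h
      · rw [hc]; push_cast; ring
      · rw [Polynomial.coeff_eq_zero_of_natDegree_lt (by omega)]; ring
    · rw [firstMoment_add_C_mul, firstMoment_legendreOp, ← add_mul]
      refine mul_ne_zero (ne_of_gt ?_) hint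
      have : (0 : ℝ) ≤ d := d.cast_nonneg
      rw [hc]; nlinarith

theorem firstMoment_pos {s : ℝ} (hs : 0 < s) {h : Polynomial ℝ} (hh : h ≠ 0) :
    0 < firstMoment s (h ^ 2 * Polynomial.X -
      h * Polynomial.derivative h * (Polynomial.C (s ^ 2) - Polynomial.X ^ 2)) := by
  set w : Polynomial ℝ := Polynomial.C (s ^ 2) - Polynomial.X ^ 2 with hw
  have hw' : Polynomial.derivative w = -(Polynomial.C 2 * Polynomial.X) := by
    rw [hw, Polynomial.derivative_sub, Polynomial.derivative_C, Polynomial.derivative_X_sq, zero_sub]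
  have h2 : (Polynomial.C 2⁻¹ * Polynomial.C 2 : Polynomial ℝ) = 1 := by
    rw [← Polynomial.C_mul]; norm_num
  have hkey : (h ^ 2 * Polynomial.X - h * Polynomial.derivative h * w) * Polynomial.X =
      Polynomial.derivative (-(Polynomial.C 2⁻¹ * (h ^ 2 * w * Polynomial.X))) +
        Polynomial.C 2⁻¹ * (h ^ 2 * w) := by
    simp only [Polynomial.derivative_neg, Polynomial.derivative_mul, hw', Polynomial.derivative_C,
      Polynomial.derivative_X, Polynomial.derivative_sq]
    linear_combination (h * Polynomial.derivative h * w * Polynomial.X -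
      h ^ 2 * Polynomial.X ^ 2) * h2
  have hpos : 0 < ∫ t in -s..s, (h ^ 2 * w).eval t := by
    refine intervalIntegral.integral_pos (by linarith) (Polynomial.continuous _).continuousOn
      (fun t ht => ?_) ?_
    · simp only [hw, Polynomial.eval_mul, Polynomial.eval_pow, Polynomial.eval_sub,
        Polynomial.eval_C, Polynomial.eval_X]
      exact mul_nonneg (sq_nonneg _) (by nlinarith [ht.1, ht.2])
    · obtain ⟨t, ht, hroot⟩ : ∃ t ∈ Set.Ioo (-s) s, ¬ h.IsRoot t := by
        by_contra! hall
        exact hh (h.eq_zero_of_infinite_isRoot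
          ((Set.Ioo_infinite (by linarith : -s < s)).mono hall))
      refine ⟨t, Set.Ioo_subset_Icc_self ht, ?_⟩
      simp only [hw, Polynomial.eval_mul, Polynomial.eval_pow, Polynomial.eval_sub,
        Polynomial.eval_C, Polynomial.eval_X]
      exact mul_pos ((sq_nonneg _).lt_of_ne' (pow_ne_zero 2 hroot)) (by nlinarith [ht.1, ht.2])
  rw [firstMoment, hkey]
  simp only [Polynomial.eval_add]
  rw [intervalIntegral.integral_add ((Polynomial.continuous _).intervalIntegrable _ _)
    ((Polynomial.continuous _).intervalIntegrable _ _), integral_derivative_eval]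
  simp only [Polynomial.eval_C_mul, intervalIntegral.integral_const_mul]
  have hb : (-(Polynomial.C 2⁻¹ * (h ^ 2 * w * Polynomial.X))).eval s = 0 := by simp [hw]
  have hb' : (-(Polynomial.C 2⁻¹ * (h ^ 2 * w * Polynomial.X))).eval (-s) = 0 := by simp [hw]
  rw [hb, hb']
  linarith

end legendre

section ideals

variable {s : ℝ} {N K : Submodule ℝ (MvPolynomial (Fin 3) ℝ)}

theorem zonal_mul_X_zero_mem (hbr : ∀ f ∈ N, ∀ g ∈ N, lieBr f g ∈ N) (hX : X 0 ∈ N)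
    {p : Polynomial ℝ} (hp : zonal p ∈ N) (r : Polynomial ℝ) :
    zonal (r.comp (Polynomial.derivative p ^ 2)) * X 0 ∈ N := by
  set q := Polynomial.derivative p with hq
  have hpow (n : ℕ) : zonal ((q ^ 2) ^ n) * X 0 ∈ N := by
    induction n with
    | zero => simpa using hX
    | succ n ih =>
      have h := N.neg_mem (hbr _ hp _ (hbr _ hp _ ih))
      rwa [lieBr_zonal_mul_X_zero, lieBr_zonal_mul_X_one, neg_neg, ← hq, ← mul_assoc, ← sq,
        ← pow_succ'] at h
  induction r using Polynomial.induction_on' with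
  | add f g hf hg => simpa [add_mul] using N.add_mem hf hg
  | monomial n a =>
    rw [Polynomial.monomial_comp, map_mul, zonal_C, mul_assoc, ← MvPolynomial.smul_eq_C_mul]
    exact N.smul_mem a (hpow n)

/-- An ideal of a Poisson algebra of polynomials that contains a nonzero zonal multiple of `X₀`
contains all coordinates. -/
theorem X_mem_of_zonal_mul_X_zero_mem (hs : 0 < s) (hKN : K ≤ N)
    (hsph : ∀ f, sphereGen s * f ∈ K) (hX : ∀ i, X i ∈ N)
    (hbr : ∀ f ∈ N, ∀ g ∈ K, lieBr f g ∈ K) {h : Polynomial ℝ} (hh : h ≠ 0)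
    (hK : zonal h * X 0 ∈ K) (i : Fin 3) : X i ∈ K := by
  have h1 : zonal h * X 1 ∈ K := by
    have := hbr _ (hX 2) _ hK
    rwa [← zonal_X, lieBr_zonal_mul_X_zero, Polynomial.derivative_X, one_mul] at this
  have hg := hbr _ (hKN hK) _ h1
  rw [lieBr_zonal_mul_X_zero_mul_X_one s, K.sub_mem_iff_left (hsph _)] at hg
  have h2 : X 2 ∈ K := by
    rw [← zonal_X]
    refine X_mem_of_firstMoment_ne_zero (s := s) (K.comap zonal.toLinearMap) (fun q hq => ?_) _ hg
      (Nat.le_succ _) (firstMoment_pos hs hh).ne'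
    have hq' (j) := hbr _ (hX j) _ (hbr _ (hX j) _ hq)
    have := K.add_mem (hq' 0) (hq' 1)
    rw [AlgHom.toLinearMap_apply, lieBr_casimir_zonal s q] at this
    exact (K.add_mem_iff_left (hsph _)).1 this
  have h0 : X 0 ∈ K := lieBr_X_one_X_two (k := ℝ) ▸ hbr _ (hX 1) _ h2
  have h1 : X 1 ∈ K := lieBr_X_two_X_zero (k := ℝ) ▸ hbr _ (hX 2) _ h0
  fin_cases i
  exacts [h0, h1, h2]

end ideals

theorem mem_sphereIdeal {s : ℝ} {f : MvPolynomial (Fin 3) ℝ} :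
    f ∈ sphereIdeal s ↔ ∃ g, f = sphereGen s * g :=
  Ideal.mem_span_singleton

theorem toSphere_sphereGen_mul (s : ℝ) (f : MvPolynomial (Fin 3) ℝ) :
    toSphere s (sphereGen s * f) = 0 :=
  Ideal.Quotient.eq_zero_iff_mem.2 (mem_sphereIdeal.2 ⟨f, rfl⟩)

theorem pbS_toSphere (s : ℝ) (f g : MvPolynomial (Fin 3) ℝ) :
    pbS s (toSphere s f) (toSphere s g) = toSphere s (lieBr f g) := by
  have hrep (f) : ∃ f', rep s (toSphere s f) = f + sphereGen s * f' := by
    obtain ⟨f', hf'⟩ := mem_sphereIdeal.1 (Ideal.Quotient.eq.1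
      (Ideal.Quotient.mk_surjective (I := sphereIdeal s) (toSphere s f)).choose_spec)
    exact ⟨f', by rw [← hf']; simp [rep]⟩
  obtain ⟨f', hf⟩ := hrep f
  obtain ⟨g', hg⟩ := hrep g
  change toSphere s (lieBr (rep s (toSphere s f)) (rep s (toSphere s g))) = _
  rw [hf, hg]
  simp only [lieBr_add_left, lieBr_add_right, lieBr_sphereGen_mul_left,
    lieBr_sphereGen_mul_right, map_add, toSphere_sphereGen_mul, add_zero]

/-- The quotient map as a linear map. -/
def toSphereₗ (s : ℝ) : MvPolynomial (Fin 3) ℝ →ₗ[ℝ] SpherePoly s :=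
  (Ideal.Quotient.mkₐ ℝ (sphereIdeal s)).toLinearMap

@[simp] theorem toSphereₗ_apply (s : ℝ) (f : MvPolynomial (Fin 3) ℝ) :
    toSphereₗ s f = toSphere s f := rfl

/-- **No nontrivial quantization of `P¹` extends beyond `P¹`** (Theorem 2.11): for every
Poisson subalgebra `C` of `P` strictly containing `P¹`, every admissible quantization of
`(C, P¹)` is trivial. -/
theorem noGo_any_extension (s : ℝ) (hs : 0 < s)
    (Cs : Submodule ℝ (SpherePoly s))
    (hpoisson : ∀ p ∈ Cs, ∀ q ∈ Cs, pbS s p q ∈ Cs)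
    (hP1 : P1 s < Cs)
    (V : Type) [NormedAddCommGroup V] [InnerProductSpace ℂ V]
    [FiniteDimensional ℂ V] [Nontrivial V]
    (Q : ↥Cs →ₗ[ℝ] Module.End ℂ V)
    (hselfadj : ∀ f : Cs, (Q f).IsSymmetric)
    (hbracket : ∀ f g : Cs,
      Q ⟨pbS s f g, hpoisson f f.2 g g.2⟩ = -Complex.I • (Q f * Q g - Q g * Q f))
    (hone : Q ⟨1, hP1.le (one_mem_P1 s)⟩ = 1)
    (hirred : ∀ W : Submodule ℂ V,
      (∀ i : Fin 3, ∀ v ∈ W, Q ⟨S s i, hP1.le (S_mem_P1 s i)⟩ v ∈ W) → W = ⊥ ∨ W = ⊤) :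
    ∀ i : Fin 3, Q ⟨S s i, hP1.le (S_mem_P1 s i)⟩ = 0 := by
  set N := Cs.comap (toSphereₗ s)
  set K := ((LinearMap.ker Q).map Cs.subtype).comap (toSphereₗ s) with hKdef
  have hKmem {f : MvPolynomial (Fin 3) ℝ} :
      f ∈ K ↔ ∃ h : toSphere s f ∈ Cs, Q ⟨toSphere s f, h⟩ = 0 := by
    simp [hKdef]
  have hXN (i) : X i ∈ N := hP1.le (S_mem_P1 s i)
  have hbrN : ∀ f ∈ N, ∀ g ∈ N, lieBr f g ∈ N := fun f hf g hg => by
    have := hpoisson _ hf _ hg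
    rwa [toSphereₗ_apply, toSphereₗ_apply, pbS_toSphere] at this
  have hbrK : ∀ f ∈ N, ∀ g ∈ K, lieBr f g ∈ K := fun f hf g hg => by
    obtain ⟨hgC, hg0⟩ := hKmem.1 hg
    refine hKmem.2 ⟨hbrN f hf g hgC, ?_⟩
    have h := hbracket ⟨_, hf⟩ ⟨_, hgC⟩
    simp only [hg0, mul_zero, zero_mul, sub_zero, smul_zero, toSphereₗ_apply, pbS_toSphere] at h
    exact h
  have hKN : K ≤ N := fun f hf => (hKmem.1 hf).1
  have hsphK (f) : sphereGen s * f ∈ K := by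
    simp [hKdef, toSphere_sphereGen_mul]
  obtain ⟨f, hfC, hf1⟩ := SetLike.exists_of_lt hP1
  obtain ⟨f, rfl⟩ := Ideal.Quotient.mk_surjective f
  obtain ⟨p, hpN, hp⟩ := exists_zonal_two_le_natDegree (s := s) (N := N)
    (N₁ := (P1 s).comap (toSphereₗ s)) (fun f => by simp [toSphere_sphereGen_mul])
    (by simpa using one_mem_P1 s) (S_mem_P1 s) (fun f => hKN (hsphK f)) hbrN hXN hfC hf1
  obtain ⟨r, hr0, hrK⟩ : ∃ r : Polynomial ℝ, r ≠ 0 ∧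
      zonal (r.comp (Polynomial.derivative p ^ 2)) * X 0 ∈ K := by
    let ψ : Polynomial ℝ →ₗ[ℝ] SpherePoly s := toSphereₗ s ∘ₗ LinearMap.mulRight ℝ (X 0) ∘ₗ
      zonal.toLinearMap ∘ₗ (Polynomial.aeval (Polynomial.derivative p ^ 2)).toLinearMap
    let φ : Polynomial ℝ →ₗ[ℝ] Module.End ℂ V :=
      Q ∘ₗ ψ.codRestrict Cs (zonal_mul_X_zero_mem hbrN (hXN 0) hpN)
    have : Module.Finite ℝ (Module.End ℂ V) := Module.Finite.trans ℂ _
    have hφ : ¬ Function.Injective φ := fun h =>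
      Polynomial.not_finite (R := ℝ) (Module.Finite.of_injective φ h)
    rw [← LinearMap.ker_eq_bot, Submodule.eq_bot_iff] at hφ
    push Not at hφ
    obtain ⟨r, hr, hr0⟩ := hφ
    exact ⟨r, hr0, hKmem.2 ⟨zonal_mul_X_zero_mem hbrN (hXN 0) hpN r, hr⟩⟩
  have hcomp : r.comp (Polynomial.derivative p ^ 2) ≠ 0 := by
    intro h0
    rcases Polynomial.comp_eq_zero_iff.1 h0 with h | ⟨-, h⟩
    · exact hr0 h
    · have h1 : (Polynomial.derivative p ^ 2).natDegree = 0 := by rw [h, Polynomial.natDegree_C]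
      rw [Polynomial.natDegree_pow, Polynomial.natDegree_derivative] at h1
      omega
  intro i
  exact (hKmem.1 (X_mem_of_zonal_mul_X_zero_mem hs hKN hsphK hXN hbrK hcomp hrK i)).2

end
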